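/- arXiv:0808.2381 — 2 statements merged into one kernel-verified Lean document; each statement's English description precedes it below -/
import Mathlib

section
/- Let F be a free group of finite rank and let H be a finitely generated subgroup of F. Then H admits a maximum finite-index extension: there exists a subgroup M of F with H ≤ M such that H has finite index in M, and every subgroup G of F with H ≤ G in which H has finite index satisfies G ≤ M. -/
namespace MaxExt
open FreeGroup
open scoped Pointwise

variable {α : Type*} [DecidableEq α]

theorem pre_append {β : Type*} {p A B : List β} (h : p <+: A ++ B) :
    p <+: A ∨ ∃ t, p = A ++ t ∧ t <+: B := by
  obtain ⟨s, hs⟩ := h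
  rcases List.append_eq_append_iff.1 hs with ⟨a, h1, h2⟩ | ⟨a, h1, h2⟩
  · exact Or.inl ⟨a, h1.symm⟩
  · exact Or.inr ⟨a, h1, ⟨s, h2.symm⟩⟩

theorem prefix_red {L L' : List (α × Bool)} (h : Red L L') :
    ∀ p, p <+: L' → ∃ q, q <+: L ∧ FreeGroup.mk q = FreeGroup.mk p := by
  induction h with
  | refl => exact fun p hp => ⟨p, hp, rfl⟩
  | tail _ hs ih =>
    intro p hp
    suffices ∃ q, q <+: _ ∧ FreeGroup.mk q = FreeGroup.mk p by
      obtain ⟨q, hq, e⟩ := this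
      obtain ⟨q', hq', e'⟩ := ih q hq
      exact ⟨q', hq', e'.trans e⟩
    cases hs with
    | @not A B x b =>
      rcases pre_append hp with h | ⟨t, rfl, h⟩
      · exact ⟨p, h.trans (List.prefix_append _ _), rfl⟩
      · refine ⟨A ++ (x, b) :: (x, !b) :: t, ?_, ?_⟩
        · simpa using h
        · exact Quot.sound Red.Step.not

theorem mk_flatten (W : List (α × Bool)) (n : ℕ) :
    FreeGroup.mk (List.replicate n W).flatten = FreeGroup.mk W ^ n := by
  induction n with
  | zero => rfl
  | succ n ih => rw [List.replicate_succ, List.flatten_cons, ← mul_mk, ih, pow_succ']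

theorem core (H : Subgroup (FreeGroup α)) (P : FreeGroup α → Prop)
    (hP : ∀ h ∈ H, ∀ p, p <+: h.toWord → P (FreeGroup.mk p))
    (u : FreeGroup α) (W : List (α × Bool)) (hW : IsCyclicallyReduced W) (hne : W ≠ [])
    (hred : IsReduced (u.toWord ++ W)) (n : ℕ) (hn : 0 < n)
    (hmem : u * FreeGroup.mk W ^ n * u⁻¹ ∈ H) : P u := by
  set N := n * (u.toWord.length + 1) with hN
  have hN0 : N ≠ 0 := by positivity
  have hmem' : u * FreeGroup.mk W ^ N * u⁻¹ ∈ H := by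
    have := H.pow_mem hmem (u.toWord.length + 1)
    rwa [conj_pow, ← pow_mul] at this
  have hr : IsReduced (u.toWord ++ (List.replicate N W).flatten) := by
    have := IsReduced.append_flatten_replicate_append (L₃ := []) hW (by simpa using hred) hN0
    simpa using this
  set h := u * FreeGroup.mk W ^ N * u⁻¹ with hh
  have e : reduce (h.toWord ++ u.toWord) = u.toWord ++ (List.replicate N W).flatten := by
    rw [← hr.reduce_eq]
    apply reduce.sound
    rw [← mul_mk, ← mul_mk, mk_toWord, mk_toWord, mk_flatten, hh]
    group
  obtain ⟨q, hq, hqe⟩ := prefix_red (reduce.red (L := h.toWord ++ u.toWord)) u.toWord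
    (by rw [e]; exact List.prefix_append _ _)
  rw [mk_toWord] at hqe
  rcases pre_append hq with h1 | ⟨t, rfl, s, hs⟩
  · rw [← hqe]; exact hP h hmem' q h1
  · exfalso
    have h2 : FreeGroup.mk s = FreeGroup.mk (List.replicate N W).flatten := by
      have h3 : u = FreeGroup.mk t * FreeGroup.mk s := by rw [mul_mk, hs, mk_toWord]
      rw [← mul_mk, mk_toWord] at hqe
      rw [mk_flatten]
      have h4 : FreeGroup.mk t = h⁻¹ * u := by rw [← hqe]; group
      have h5 : FreeGroup.mk s = (FreeGroup.mk t)⁻¹ * u := by rw [h3]; group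
      rw [h5, h4, hh]; group
    have h6 := norm_mk_le (L₁ := s)
    rw [h2, FreeGroup.norm, toWord_mk, (hW.flatten_replicate N).isReduced.reduce_eq] at h6
    have h7 : s.length ≤ u.toWord.length := by rw [← hs]; simp
    have h8 : 0 < W.length := List.length_pos_iff.2 hne
    simp at h6
    have : N ≤ N * W.length := Nat.le_mul_of_pos_right _ h8
    have : u.toWord.length + 1 ≤ N := Nat.le_mul_of_pos_left _ hn
    omega

theorem invRev_cyc {W : List (α × Bool)} (hW : IsCyclicallyReduced W) :
    IsCyclicallyReduced (invRev W) := by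
  refine ⟨?_, ?_⟩
  · rw [isReduced_iff_reduce_eq, reduce_invRev, hW.1.reduce_eq]
  · intro a ha b hb hab
    simp only [invRev, List.getLast?_reverse, List.head?_reverse, List.head?_map,
      List.getLast?_map, Option.mem_def, Option.map_eq_some_iff] at ha hb
    obtain ⟨a', ha', rfl⟩ := ha
    obtain ⟨b', hb', rfl⟩ := hb
    have := hW.2 b' hb' a' ha' hab.symm
    simp [this]

theorem red_or {U W : List (α × Bool)} (hU : IsReduced U) (hW : IsCyclicallyReduced W) :
    IsReduced (U ++ W) ∨ IsReduced (U ++ invRev W) := by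
  by_contra! hc
  obtain ⟨h1, h2⟩ := hc
  have hI := (invRev_cyc hW).1
  unfold FreeGroup.IsReduced at *
  rw [List.isChain_append] at h1 h2
  have hW1 : List.IsChain (fun a b : α × Bool => a.1 = b.1 → a.2 = b.2) W := hW.1
  simp only [hU, hW1, hI, true_and] at h1 h2
  push Not at h1 h2
  obtain ⟨x, hx, y, hy, hxy, hxy'⟩ := h1
  obtain ⟨x', hx', z, hz, hxz, hxz'⟩ := h2
  obtain rfl : x = x' := by
    simp only [Option.mem_def] at hx hx'
    rw [hx] at hx'; exact Option.some.inj hx'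
  simp only [invRev, List.head?_reverse,
      List.getLast?_map, Option.mem_def, Option.map_eq_some_iff] at hz
  obtain ⟨z', hz', rfl⟩ := hz
  have := hW.2 z' hz' y hy (by simp at hxz; rw [← hxz, hxy])
  simp at hxz'
  rw [this] at hxz'
  revert hxy' hxz'
  cases x.2 <;> cases y.2 <;> simp

/-- Prefixes of elements of a finitely generated subgroup stay close to it. -/
theorem close (S : Finset (FreeGroup α)) (C : ℕ) (hC : ∀ s ∈ S, norm s ≤ C)
    (h : FreeGroup α) (hh : h ∈ Subgroup.closure (S : Set (FreeGroup α))) :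
    ∀ p, p <+: h.toWord → ∃ k ∈ Subgroup.closure (S : Set (FreeGroup α)), ∃ c : FreeGroup α,
      norm c ≤ C ∧ FreeGroup.mk p = k * c := by
  have key : ∀ x ∈ Subgroup.closure (S : Set (FreeGroup α)), ∀ y : FreeGroup α, norm y ≤ C →
      (∀ p, p <+: x.toWord → ∃ k ∈ Subgroup.closure (S : Set (FreeGroup α)), ∃ c : FreeGroup α,
      norm c ≤ C ∧ FreeGroup.mk p = k * c) →
      (∀ p, p <+: (x * y).toWord → ∃ k ∈ Subgroup.closure (S : Set (FreeGroup α)),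
        ∃ c : FreeGroup α, norm c ≤ C ∧ FreeGroup.mk p = k * c) := by
    intro x hx y hy ih p hp
    rw [toWord_mul] at hp
    obtain ⟨q, hq, hqe⟩ := prefix_red reduce.red p hp
    rw [← hqe]
    rcases pre_append hq with h1 | ⟨t, rfl, ht⟩
    · exact ih q h1
    · refine ⟨x, hx, FreeGroup.mk t, ?_, ?_⟩
      · exact norm_mk_le.trans (ht.length_le.trans hy)
      · rw [← mul_mk, mk_toWord]
  induction hh using Subgroup.closure_induction_right with
  | one =>
    intro p hp
    simp at hp
    subst hp
    exact ⟨1, one_mem _, 1, by simp, rfl⟩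
  | mul_right x hx y hy ih => exact key x hx y (hC y hy) ih
  | mul_inv_cancel x hx y hy ih => exact key x hx y⁻¹ (by rw [norm_inv_eq]; exact hC y hy) ih

theorem finite_ball [Finite α] (C : ℕ) : {x : FreeGroup α | norm x ≤ C}.Finite := by
  have := List.finite_length_le (α × Bool) C
  exact Set.Finite.of_finite_image (f := toWord)
    (this.subset (by rintro _ ⟨x, hx, rfl⟩; exact hx)) toWord_injective.injOn

theorem cover [Finite α] (H : Subgroup (FreeGroup α)) (hFG : H.FG) (hne : H ≠ ⊥) :
    ∃ T : Set (FreeGroup α), T.Finite ∧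
      ∀ g ∈ Subgroup.Commensurable.commensurator H, ∃ c ∈ T, g * c ∈ H := by
  obtain ⟨S, rfl⟩ := hFG
  set H := Subgroup.closure (S : Set (FreeGroup α)) with hH
  obtain ⟨h0, hh0, h01⟩ := (Subgroup.bot_or_exists_ne_one H).resolve_left hne
  set v := FreeGroup.mk (reduceCyclically.conjugator h0.toWord) with hv
  set W := reduceCyclically h0.toWord with hWdef
  have hW : IsCyclicallyReduced W := reduceCyclically.isCyclicallyReduced isReduced_toWord
  have h0e : h0 = v * FreeGroup.mk W * v⁻¹ := by
    rw [hv, inv_mk, mul_mk, mul_mk, hWdef, reduceCyclically.conj_conjugator_reduceCyclically,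
      mk_toWord]
  have hWne : W ≠ [] := by
    intro h
    apply h01
    rw [h0e, h, ← one_eq_mk]; simp
  set C := S.sup norm with hCdef
  have hC : ∀ s ∈ S, norm s ≤ C := fun s hs => Finset.le_sup hs
  refine ⟨(fun c => v * c⁻¹) '' {x : FreeGroup α | norm x ≤ C}, (finite_ball C).image _, ?_⟩
  intro g hg
  rw [Subgroup.Commensurable.commensurator_mem_iff] at hg
  obtain ⟨n, hn, -, hmem⟩ := Subgroup.exists_pow_mem_of_relIndex_ne_zero hg.2
    (Subgroup.smul_mem_pointwise_smul h0 (ConjAct.toConjAct g) H hh0)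
  replace hmem := (Subgroup.mem_inf.1 hmem).1
  rw [ConjAct.toConjAct_smul, conj_pow, h0e, conj_pow] at hmem
  set P : FreeGroup α → Prop := fun u => ∃ k ∈ H, ∃ c : FreeGroup α, norm c ≤ C ∧ u = k * c
    with hPdef
  have hP : ∀ h ∈ H, ∀ p, p <+: h.toWord → P (FreeGroup.mk p) := close S C hC
  have hPu : P (g * v) := by
    rcases red_or (isReduced_toWord (x := g * v)) hW with h | h
    · refine core H P hP (g * v) W hW hWne h n hn ?_
      convert hmem using 1
      group
    · refine core H P hP (g * v) (invRev W) (invRev_cyc hW) ?_ h n hn ?_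
      · intro h; apply hWne
        rw [← invRev_invRev (L₁ := W), h, invRev_empty]
      · convert H.inv_mem hmem using 1
        rw [← inv_mk, inv_pow]
        group
  obtain ⟨k, hk, c, hc, e⟩ := hPu
  refine ⟨_, ⟨c, hc, rfl⟩, ?_⟩
  have : g * (v * c⁻¹) = k := by rw [← mul_assoc, e]; group
  rw [this]; exact hk

theorem le_comm {G : Type*} [Group G] (H K : Subgroup G) (hHK : H ≤ K)
    (hK : (H.subgroupOf K).index ≠ 0) : K ≤ Subgroup.Commensurable.commensurator H := by
  intro g hg
  have hc : Subgroup.Commensurable H K :=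
    ⟨hK, by rw [Subgroup.relIndex_eq_one.2 hHK]; exact one_ne_zero⟩
  rw [hc.eq, Subgroup.Commensurable.commensurator_mem_iff]
  have : ConjAct.toConjAct g • K = K := Subgroup.conj_smul_eq_self_of_mem hg
  rw [this]

end MaxExt

theorem max_finite_index_extension (r : ℕ) (H : Subgroup (FreeGroup (Fin r)))
    (hFG : H.FG) :
    ∃ M : Subgroup (FreeGroup (Fin r)), H ≤ M ∧ (H.subgroupOf M).index ≠ 0 ∧
      ∀ G : Subgroup (FreeGroup (Fin r)), H ≤ G → (H.subgroupOf G).index ≠ 0 → G ≤ M := by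
  by_cases hne : H = ⊥
  · subst hne
    refine ⟨⊥, le_rfl, by simp, ?_⟩
    intro G _ hG g hg
    obtain ⟨n, hn, -, h⟩ := Subgroup.exists_pow_mem_of_index_ne_zero hG ⟨g, hg⟩
    have h' : g ^ n = 1 := by simpa [Subgroup.mem_subgroupOf] using h
    rw [Subgroup.mem_bot]
    exact (pow_eq_one_iff_left hn.ne').1 h'
  · have hsub : ∀ G : Subgroup (FreeGroup (Fin r)), H ≤ G → (H.subgroupOf G).index ≠ 0 →
        G ≤ Subgroup.Commensurable.commensurator H := by
      exact fun G => MaxExt.le_comm H G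
    obtain ⟨T, hT, hcov⟩ := MaxExt.cover H hFG hne
    refine ⟨_, hsub H le_rfl (by simp), ?_, hsub⟩
    set M := Subgroup.Commensurable.commensurator H
    have := hT.to_subtype
    have key : ∀ q : M ⧸ H.subgroupOf M, ∃ c : T, ((q.out : M) : FreeGroup (Fin r))⁻¹ * c ∈ H := by
      intro q
      obtain ⟨c, hc, h⟩ := hcov _ (M.inv_mem q.out.2)
      exact ⟨⟨c, hc⟩, h⟩
    choose f hf using key
    have hinj : Function.Injective f := by
      intro a b hab
      rw [← Quotient.out_eq' a, ← Quotient.out_eq' b]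
      apply QuotientGroup.eq.2
      rw [Subgroup.mem_subgroupOf]
      have h1 := hf a
      have h2 := hf b
      rw [hab] at h1
      have h3 := H.mul_mem h1 (H.inv_mem h2)
      convert h3 using 1
      simp
    have := Finite.of_injective f hinj
    exact (Subgroup.finiteIndex_of_finite_quotient (H := H.subgroupOf M)).index_ne_zero
end

section
/- Let F be a free group of finite rank and let H be a finitely generated subgroup of F. Then the set of finite-index extensions of H, namely {G : Subgroup F | H ≤ G ∧ H has finite index in G}, is finite. -/
namespace FIE
open FreeGroup

variable {α : Type*}

/-- All prefixes of `L` evaluate into `A`. -/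
def Good (A : Set (FreeGroup α)) (L : List (α × Bool)) : Prop :=
  ∀ p q, L = p ++ q → mk p ∈ A

theorem Good.step {A : Set (FreeGroup α)} {L L' : List (α × Bool)} (h : Good A L)
    (hs : Red.Step L L') : Good A L' := by
  cases hs with
  | @not L1 L2 x b =>
    intro p q hpq
    rcases List.append_eq_append_iff.1 hpq with ⟨t, rfl, rfl⟩ | ⟨t, rfl, rfl⟩
    · have := h (L1 ++ (x, b) :: (x, !b) :: t) q (by simp)
      have e : mk (L1 ++ (x, b) :: (x, !b) :: t) = mk (L1 ++ t) :=
        Quot.sound Red.Step.not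
      rwa [e] at this
    · exact h p (t ++ (x, b) :: (x, !b) :: L2) (by simp)

theorem Good.red {A : Set (FreeGroup α)} {L L' : List (α × Bool)} (h : Good A L)
    (hs : Red L L') : Good A L' := by
  induction hs with
  | refl => exact h
  | tail _ hs ih => exact ih.step hs

theorem quasiconvex [DecidableEq α] (H : Subgroup (FreeGroup α)) (hFG : H.FG) :
    ∃ U : Set (FreeGroup α), U.Finite ∧ ∀ x ∈ H, ∀ p q, x.toWord = p ++ q →
      ∃ u ∈ U, ∃ h ∈ H, mk p = h * u := by
  obtain ⟨S, rfl⟩ := hFG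
  let U : Set (FreeGroup α) := {1} ∪ ⋃ s ∈ S, mk '' {p | p ∈ (toWord s).inits}
  refine ⟨U, ?_, ?_⟩
  · refine (Set.finite_singleton _).union (S.finite_toSet.biUnion fun s _ => ?_)
    exact (List.finite_toSet _).image _
  let A : Set (FreeGroup α) :=
    {g | ∃ u ∈ U, ∃ h ∈ Subgroup.closure (S : Set (FreeGroup α)), g = h * u}
  have hA : ∀ h ∈ Subgroup.closure (S : Set (FreeGroup α)), ∀ g ∈ A, h * g ∈ A := by
    rintro h hh _ ⟨u, hu, k, hk, rfl⟩
    exact ⟨u, hu, h * k, mul_mem hh hk, by group⟩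
  have key : ∀ x ∈ Subgroup.closure (S : Set (FreeGroup α)), ∃ L, mk L = x ∧ Good A L := by
    intro x hx
    induction hx using Subgroup.closure_induction with
    | mem x hx =>
      refine ⟨x.toWord, mk_toWord, fun p q h => ⟨mk p, Or.inr ?_, 1, one_mem _, by simp⟩⟩
      refine Set.mem_biUnion hx ⟨p, ?_, rfl⟩
      simp [List.mem_inits, h]
    | one =>
      refine ⟨[], rfl, fun p q h => ?_⟩
      obtain ⟨rfl, rfl⟩ := List.append_eq_nil_iff.1 h.symm
      exact ⟨1, Or.inl rfl, 1, one_mem _, by simp [one_eq_mk]⟩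
    | mul x y hx hy ihx ihy =>
      obtain ⟨L, rfl, hL⟩ := ihx
      obtain ⟨M, rfl, hM⟩ := ihy
      refine ⟨L ++ M, mul_mk.symm, fun p q h => ?_⟩
      rcases List.append_eq_append_iff.1 h with ⟨t, rfl, rfl⟩ | ⟨t, rfl, rfl⟩
      · rw [← mul_mk]
        exact hA _ hx _ (hM _ _ rfl)
      · exact hL _ _ rfl
    | inv x hx ih =>
      obtain ⟨L, rfl, hL⟩ := ih
      refine ⟨invRev L, inv_mk.symm, fun p q h => ?_⟩
      have h2 : L = invRev q ++ invRev p := by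
        rw [← invRev_append, ← h, invRev_invRev]
      have h3 := hA _ (inv_mem hx) _ (hL _ _ h2)
      have e : (mk L)⁻¹ * mk (invRev q) = mk p := by
        rw [h2, ← mul_mk, ← inv_mk, ← inv_mk]; group
      rwa [e] at h3
  intro x hx p q hpq
  obtain ⟨L, rfl, hL⟩ := key x hx
  rw [toWord_mk] at hpq
  exact hL.red reduce.red p q hpq

theorem left_mul (a b1 b2 : List (α × Bool)) (h : IsReduced (b1 ++ b2))
    (hl : a.length ≤ b1.length) :
    ∃ c, IsReduced (c ++ b2) ∧ mk c = mk a * mk b1 ∧ b1.length ≤ c.length + a.length := by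
  induction a with
  | nil => exact ⟨b1, h, by simp [← one_eq_mk], by simp⟩
  | cons l a ih =>
    simp only [List.length_cons] at hl
    obtain ⟨c, hc, hm, hlen⟩ := ih (by omega)
    have e : mk (l :: a) * mk b1 = mk [l] * mk c := by
      rw [hm, ← mul_assoc, mul_mk]; rfl
    match c, hc, hm, hlen with
    | [], _, _, hlen => simp at hlen; omega
    | x :: t, hc, hm, hlen =>
      by_cases hx : l.1 = x.1 → l.2 = x.2
      · refine ⟨l :: x :: t, ?_, ?_, ?_⟩
        · simp only [List.cons_append] at hc ⊢
          exact List.isChain_cons_cons.2 ⟨hx, hc⟩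
        · rw [e, mul_mk]; rfl
        · simp at hlen ⊢; omega
      · push Not at hx
        refine ⟨t, hc.infix ⟨[x], [], by simp⟩, ?_, ?_⟩
        · obtain ⟨l1, l2⟩ := l
          obtain ⟨x1, x2⟩ := x
          obtain ⟨rfl, h2⟩ := hx
          have h3 : x2 = !l2 := by cases l2 <;> cases x2 <;> simp_all
          subst h3
          rw [e, mul_mk]
          exact (Quot.sound (Red.Step.not (L₁ := []))).symm
        · simp at hlen ⊢; omega

theorem isReduced_invRev [DecidableEq α] {L : List (α × Bool)} (h : IsReduced L) :
    IsReduced (invRev L) := by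
  rw [isReduced_iff_reduce_eq, reduce_invRev, h.reduce_eq]

theorem right_mul [DecidableEq α] (d b1 b2 : List (α × Bool)) (h : IsReduced (b1 ++ b2))
    (hl : d.length ≤ b2.length) :
    ∃ c, IsReduced (b1 ++ c) ∧ mk c = mk b2 * mk d := by
  have h' := isReduced_invRev h
  rw [invRev_append] at h'
  obtain ⟨c, hc, hm, -⟩ := left_mul (invRev d) _ _ h' (by simpa using hl)
  refine ⟨invRev c, ?_, ?_⟩
  · simpa using isReduced_invRev hc
  · rw [← inv_mk, hm, ← inv_mk, ← inv_mk]; group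

theorem mk_flatten (c : List (α × Bool)) (n : ℕ) :
    mk (List.replicate n c).flatten = mk c ^ n := by
  rw [pow_mk]

theorem cosets [DecidableEq α] (H : Subgroup (FreeGroup α)) (hFG : H.FG) (hH : H ≠ ⊥) :
    ∃ V : Set (FreeGroup α), V.Finite ∧ ∀ G : Subgroup (FreeGroup α), H ≤ G →
      (H.subgroupOf G).index ≠ 0 → ∀ g ∈ G, ∃ v ∈ V, ∃ h ∈ H, g = h * v := by
  obtain ⟨U, hU, hq⟩ := quasiconvex H hFG
  obtain ⟨⟨y, hx⟩, hx1'⟩ := Subgroup.ne_bot_iff_exists_ne_one.1 hH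
  have hx1 : y ≠ 1 := fun h0 => hx1' (Subtype.ext h0)
  set c := reduceCyclically y.toWord with hc
  set w := mk (reduceCyclically.conjugator y.toWord) with hw
  have hcr : IsCyclicallyReduced c := reduceCyclically.isCyclicallyReduced isReduced_toWord
  have hy : y = w * mk c * w⁻¹ := by
    rw [hw, hc, inv_mk, mul_mk, mul_mk, reduceCyclically.conj_conjugator_reduceCyclically,
      mk_toWord]
  have hc0 : 0 < c.length := by
    rw [List.length_pos_iff]
    intro h0
    apply hx1
    rw [hy, h0, ← one_eq_mk]; group
  refine ⟨(fun u => u * w⁻¹) '' U, hU.image _, ?_⟩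
  intro G hHG hidx g hg
  have hk : g * y * g⁻¹ ∈ G := mul_mem (mul_mem hg (hHG hx)) (inv_mem hg)
  obtain ⟨N, hN, -, hmem⟩ := Subgroup.exists_pow_mem_of_index_ne_zero hidx ⟨_, hk⟩
  replace hmem : (g * y * g⁻¹) ^ N ∈ H := by simpa [Subgroup.mem_subgroupOf] using hmem
  set a := (g * w).toWord with ha
  set K := a.length with hK
  set b := (List.replicate (N * K) c).flatten with hb
  have hbm : mk b = mk c ^ (N * K) := mk_flatten _ _
  have hbl : K ≤ b.length := by
    have hl : b.length = N * K * c.length := by simp [hb]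
    rw [hl]
    calc K = 1 * K * 1 := by simp
      _ ≤ N * K * c.length := by gcongr <;> omega
  have hbb : IsReduced (b ++ b) := by
    have := (hcr.flatten_replicate (N * K + N * K)).isReduced
    rwa [List.replicate_add, List.flatten_append] at this
  obtain ⟨p, hp, hpm, -⟩ := left_mul a b b hbb hbl
  obtain ⟨q, hq1, hqm⟩ := right_mul (invRev a) p b hp (by simpa using hbl)
  have ham : mk a = g * w := mk_toWord
  have hconj : ∀ n, (g * y * g⁻¹) ^ n = g * w * mk c ^ n * (g * w)⁻¹ := by
    intro n
    rw [hy, ← conj_pow]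
    congr 1
    group
  have hpow : ∀ j, (g * y * g⁻¹) ^ (N * j) ∈ H := fun j => by
    rw [pow_mul]; exact pow_mem hmem j
  have hz : mk (p ++ q) = (g * y * g⁻¹) ^ (N * (K + K)) := by
    rw [← mul_mk, hpm, hqm, hconj, ham, hbm, ← inv_mk, ham, mul_add, pow_add]
    group
  have hz2 : mk (p ++ q) ∈ H := hz ▸ hpow _
  obtain ⟨u, hu, h, hh, e⟩ := hq _ hz2 p q (by rw [toWord_mk, hq1.reduce_eq])
  refine ⟨u * w⁻¹, ⟨u, hu, rfl⟩, ((g * y * g⁻¹) ^ (N * K))⁻¹ * h, mul_mem (inv_mem (hpow _)) hh, ?_⟩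
  have e2 : h = g * w * mk c ^ (N * K) * u⁻¹ := by
    rw [eq_mul_inv_iff_mul_eq, ← e, hpm, ham, hbm]
  rw [e2, hconj]
  group

end FIE

theorem finite_index_extensions_finite (r : ℕ) (H : Subgroup (FreeGroup (Fin r)))
    (hFG : H.FG) :
    {G : Subgroup (FreeGroup (Fin r)) | H ≤ G ∧ (H.subgroupOf G).index ≠ 0}.Finite := by
  by_cases hH : H = ⊥
  · subst hH
    refine (Set.finite_singleton ⊥).subset ?_
    rintro G ⟨-, hidx⟩
    refine (Subgroup.eq_bot_iff_forall G).2 fun g hg => ?_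
    obtain ⟨N, hN, -, hmem⟩ := Subgroup.exists_pow_mem_of_index_ne_zero hidx ⟨g, hg⟩
    have h1 : g ^ N = 1 := by simpa [Subgroup.mem_subgroupOf, -pow_eq_one_iff] using hmem
    exact (pow_eq_one_iff_left hN.ne').1 h1
  · obtain ⟨V, hV, h⟩ := FIE.cosets H hFG hH
    refine Set.Finite.of_finite_image (f := fun G : Subgroup (FreeGroup (Fin r)) => V ∩ G)
      (hV.finite_subsets.subset ?_) ?_
    · rintro _ ⟨G, -, rfl⟩
      exact Set.inter_subset_left
    · have aux : ∀ G G' : Subgroup (FreeGroup (Fin r)), H ≤ G → (H.subgroupOf G).index ≠ 0 →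
          H ≤ G' → V ∩ G = V ∩ G' → G ≤ G' := by
        intro G G' h1 h2 h3 e g hg
        obtain ⟨v, hv, k, hk, rfl⟩ := h G h1 h2 g hg
        have hvG : v ∈ G := (G.mul_mem_cancel_left (h1 hk)).1 hg
        have : v ∈ V ∩ (G' : Set _) := e ▸ ⟨hv, hvG⟩
        exact mul_mem (h3 hk) this.2
      rintro G ⟨h1, h2⟩ G' ⟨h3, h4⟩ e
      exact le_antisymm (aux G G' h1 h2 h3 e) (aux G' G h3 h4 h1 e.symm)
end
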